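/- Let f(t) = t^4 + a t^3 + b t^2 + a q t + q^2 be a polynomial in P_A, and let K^+ = Q[t]/(f^+(t)) where f^+(t) = t^2 + a t + (b − 2q), with ring of integers O^+. If q is even, then a is odd and 2 is inert in K^+, i.e., 2·O^+ is a prime ideal. If a is even and a + b is not congruent to 1 mod 4, then 2 ramifies in K^+, i.e., 2·O^+ is the square of a maximal ideal. -/

import Mathlib

open Polynomial NumberField

/-- The Weil polynomial `t^4 + a t^3 + b t^2 + a q t + q^2` over `ℤ`. -/
noncomputable def weilPoly (q : ℕ) (a b : ℤ) : Polynomial ℤ :=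
  X ^ 4 + C a * X ^ 3 + C b * X ^ 2 + C (a * q) * X + C ((q : ℤ) ^ 2)

/-- Condition (a): `b = a^2 - q`, `b < 0`, every prime divisor of `b` is `≡ 1 mod 3`. -/
def PAcond (q : ℕ) (a b : ℤ) : Prop :=
  b = a ^ 2 - q ∧ b < 0 ∧ ∀ ℓ : ℕ, ℓ.Prime → (ℓ : ℤ) ∣ b → ℓ % 3 = 1

/-- Condition (b) on the middle coefficient `b` (for `a = 0`), where `q = p^m`. -/
def PBcond (q p : ℕ) (b : ℤ) : Prop :=
  b = 1 - 2 * q ∨ (b = 2 - 2 * q ∧ 2 < p) ∨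
    (b = -(q : ℤ) ∧ ((p % 12 = 11 ∧ IsSquare q) ∨ (p = 3 ∧ IsSquare q) ∨
      (p = 2 ∧ ¬ IsSquare q))) ∨
    (q = 2 ∧ b = -4) ∨ (q = 3 ∧ b = -6)

/-- `f ∈ P_A`: Weil polynomial, irreducible over `ℚ`, satisfying condition (a). -/
noncomputable def inPA (q p m : ℕ) (a b : ℤ) : Prop :=
  p.Prime ∧ q = p ^ m ∧ 0 < m ∧
    Irreducible ((weilPoly q a b).map (Int.castRingHom ℚ)) ∧ PAcond q a b

/-- `f ∈ P_B`: Weil polynomial `t^4 + b t^2 + q^2`, irreducible over `ℚ`,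
satisfying condition (b). -/
noncomputable def inPB (q p m : ℕ) (b : ℤ) : Prop :=
  p.Prime ∧ q = p ^ m ∧ 0 < m ∧
    Irreducible ((weilPoly q 0 b).map (Int.castRingHom ℚ)) ∧ PBcond q p b

theorem finrank_le_two_of_adjoin_quadratic {K : Type*} [Field K] [NumberField K] {x : K} {a c : ℤ}
    (hx : x ^ 2 + a * x + c = 0) (hgen : Algebra.adjoin ℚ {x} = ⊤) :
    Module.finrank ℚ K ≤ 2 := by
  have hint : IsIntegral ℚ x := Algebra.IsIntegral.isIntegral x
  have htop : IntermediateField.adjoin ℚ {x} = ⊤ := by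
    rw [← IntermediateField.toSubalgebra_inj,
      IntermediateField.adjoin_simple_toSubalgebra_of_isAlgebraic hint.isAlgebraic, hgen,
      IntermediateField.top_toSubalgebra]
  rw [← IntermediateField.finrank_top', ← htop, IntermediateField.adjoin.finrank hint]
  have hmonic : (X ^ 2 + C (a : ℚ) * X + C (c : ℚ)).Monic := by monicity!
  have hdeg : (X ^ 2 + C (a : ℚ) * X + C (c : ℚ)).natDegree = 2 := by compute_degree!
  rw [← hdeg]
  refine natDegree_le_of_dvd (minpoly.dvd ℚ x ?_) hmonic.ne_zero
  simpa using hx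

theorem absNorm_span_two (K : Type*) [Field K] [NumberField K] :
    Ideal.absNorm (Ideal.span {(2 : 𝓞 K)}) = 2 ^ Module.finrank ℚ K := by
  have h := Algebra.norm_algebraMap (S := 𝓞 K) (2 : ℤ)
  rw [map_ofNat] at h
  rw [Ideal.absNorm_span_singleton, h, Int.natAbs_pow, RingOfIntegers.rank]
  rfl

theorem absNorm_ne_two_of_root {K : Type*} [Field K] [NumberField K] {r : 𝓞 K} {a c : ℤ}
    (hr : r ^ 2 + a * r + c = 0) (ha : Odd a) (hc : Odd c) {M : Ideal (𝓞 K)} (hM : M.IsMaximal)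
    (h2 : (2 : 𝓞 K) ∈ M) : Ideal.absNorm M ≠ 2 := by
  intro hcard
  let := Ideal.Quotient.field M
  have hcard' : Nat.card (𝓞 K ⧸ M) = 2 := by
    rwa [Ideal.absNorm_apply, Submodule.cardQuot_apply] at hcard
  have : Finite (𝓞 K ⧸ M) := Nat.finite_of_card_ne_zero (by omega)
  let := Fintype.ofFinite (𝓞 K ⧸ M)
  have hfrob := FiniteField.pow_card (Ideal.Quotient.mk M r)
  rw [← Nat.card_eq_fintype_card, hcard'] at hfrob
  have htwo : (2 : 𝓞 K ⧸ M) = 0 := by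
    rw [← map_ofNat (Ideal.Quotient.mk M) 2]
    exact Ideal.Quotient.eq_zero_iff_mem.mpr h2
  have hroot := congrArg (Ideal.Quotient.mk M) hr
  obtain ⟨k, rfl⟩ := ha
  obtain ⟨l, rfl⟩ := hc
  simp only [map_add, map_mul, map_pow, map_intCast, map_zero, hfrob] at hroot
  push_cast at hroot
  refine one_ne_zero (α := 𝓞 K ⧸ M) ?_
  linear_combination hroot - (Ideal.Quotient.mk M r * (k + 1) + l) * htwo

theorem isPrime_span_two_of_root {K : Type*} [Field K] [NumberField K] {r : 𝓞 K} {a c : ℤ}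
    (hr : r ^ 2 + a * r + c = 0) (ha : Odd a) (hc : Odd c) (hdeg : Module.finrank ℚ K ≤ 2) :
    (Ideal.span {(2 : 𝓞 K)}).IsPrime := by
  have hN := absNorm_span_two K
  have hpos : 0 < Module.finrank ℚ K := Module.finrank_pos
  have hne : Ideal.span {(2 : 𝓞 K)} ≠ ⊤ := by
    intro h
    rw [h, Ideal.absNorm_top] at hN
    exact (Nat.one_lt_two_pow hpos.ne').ne hN
  obtain ⟨M, hM, hle⟩ := Ideal.exists_le_maximal _ hne
  obtain ⟨J, hJ⟩ := Ideal.dvd_iff_le.mpr hle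
  have hM2 := absNorm_ne_two_of_root hr ha hc hM (hle (Ideal.mem_span_singleton_self _))
  have hM1 : Ideal.absNorm M ≠ 1 := fun h => hM.ne_top (Ideal.absNorm_eq_one_iff.mp h)
  rw [hJ, map_mul] at hN
  have hJ1 : Ideal.absNorm J = 1 := by
    obtain ⟨i, hi, hMi⟩ := (Nat.dvd_prime_pow Nat.prime_two).mp (Dvd.intro _ hN)
    have hi2 : i = 2 := by
      have : i ≤ 2 := hi.trans hdeg
      interval_cases i <;> simp_all
    have hn : Module.finrank ℚ K = 2 := by omega
    rw [hMi, hi2, hn] at hN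
    omega
  rw [Ideal.absNorm_eq_one_iff] at hJ1
  rw [hJ, hJ1, Ideal.mul_top]
  exact hM.isPrime

theorem span_pair_sq_eq_span_two {R : Type*} [CommRing R] {x : R} {u w : ℤ}
    (hx : x ^ 2 = 2 * u * x + 4 * w + 2) :
    Ideal.span {(2 : R), x} ^ 2 = Ideal.span {(2 : R)} := by
  have h2 : (2 : R) ∈ Ideal.span {(2 : R), x} := Ideal.subset_span (by simp)
  have hxm : x ∈ Ideal.span {(2 : R), x} := Ideal.subset_span (by simp)
  apply le_antisymm
  · rw [pow_two, Ideal.span_pair_mul_span_pair, Ideal.span_le]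
    rintro y (rfl | rfl | rfl | rfl) <;> rw [SetLike.mem_coe, Ideal.mem_span_singleton]
    · exact Dvd.intro _ rfl
    · exact Dvd.intro _ rfl
    · exact Dvd.intro_left _ rfl
    · exact ⟨u * x + 2 * w + 1, by linear_combination hx⟩
  · rw [Ideal.span_singleton_le_iff_mem, pow_two]
    have key := sub_mem (sub_mem (Ideal.mul_mem_mul hxm hxm)
      (Ideal.mul_mem_left _ (u : R) (Ideal.mul_mem_mul h2 hxm)))
      (Ideal.mul_mem_left _ (w : R) (Ideal.mul_mem_mul h2 h2))
    convert key using 1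
    linear_combination -hx

theorem isMaximal_of_sq_eq_span_two {K : Type*} [Field K] [NumberField K]
    {I : Ideal (𝓞 K)} (hI : I ^ 2 = Ideal.span {(2 : 𝓞 K)}) (hdeg : Module.finrank ℚ K ≤ 2) :
    I.IsMaximal := by
  have hN := absNorm_span_two K
  have hpos : 0 < Module.finrank ℚ K := Module.finrank_pos
  rw [← hI, map_pow] at hN
  have hI2 : Ideal.absNorm I = 2 := by
    have hle : Ideal.absNorm I ≤ 2 := by
      have : 2 ^ Module.finrank ℚ K ≤ 2 ^ 2 := Nat.pow_le_pow_right two_pos hdeg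
      exact (Nat.pow_le_pow_iff_left two_ne_zero).mp (hN.trans_le this)
    interval_cases Module.finrank ℚ K <;> interval_cases Ideal.absNorm I <;> simp_all
  have hprime : I.IsPrime :=
    Ideal.isPrime_of_irreducible_absNorm (by rw [hI2]; exact Nat.prime_two)
  refine hprime.isMaximal ?_
  rintro rfl
  simp at hI2

/-- Let `f = t^4 + a t^3 + b t^2 + a q t + q^2 ∈ P_A` and let
`K⁺ = ℚ[t]/(f⁺)` with `f⁺(t) = t^2 + a t + (b − 2q)`, with ring of integers `O⁺`.
If `q` is even, then `a` is odd and `2` is inert in `K⁺` (`2·O⁺` is prime).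
If `a` is even and `a + b ≢ 1 mod 4`, then `2` ramifies in `K⁺`
(`2·O⁺` is the square of a maximal ideal). -/
theorem statement15 (q p m : ℕ) (a b : ℤ) (hf : inPA q p m a b)
    (Kp : Type*) [Field Kp] [NumberField Kp] (ρ : Kp)
    (hroot : Polynomial.aeval ρ (X ^ 2 + C a * X + C (b - 2 * (q : ℤ))) = 0)
    (hgen : Algebra.adjoin ℚ {ρ} = ⊤) :
    (Even q → Odd a ∧ (Ideal.span {(2 : 𝓞 Kp)}).IsPrime) ∧
      (Even a → ¬ (a + b ≡ 1 [ZMOD 4]) →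
        ∃ 𝔪 : Ideal (𝓞 Kp), 𝔪.IsMaximal ∧ Ideal.span {(2 : 𝓞 Kp)} = 𝔪 ^ 2) := by
  obtain ⟨-, -, -, -, hb, -, hdvd⟩ := hf
  have hroot' : ρ ^ 2 + (a : Kp) * ρ + ((b - 2 * q : ℤ) : Kp) = 0 := by
    simpa [map_ofNat (aeval ρ) 2] using hroot
  have hdeg := finrank_le_two_of_adjoin_quadratic hroot' hgen
  have hbodd : Odd b := by
    rw [← Int.not_even_iff_odd, even_iff_two_dvd]
    exact fun h => absurd (hdvd 2 Nat.prime_two h) (by norm_num)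
  have hint : IsIntegral ℤ ρ := by
    refine ⟨X ^ 2 + C a * X + C (b - 2 * (q : ℤ)), by monicity!, ?_⟩
    rwa [← aeval_def]
  obtain ⟨r, rfl⟩ : ∃ r : 𝓞 Kp, (r : Kp) = ρ := ⟨⟨ρ, hint⟩, rfl⟩
  have hr : r ^ 2 + (a : 𝓞 Kp) * r + ((b - 2 * q : ℤ) : 𝓞 Kp) = 0 := by
    apply RingOfIntegers.coe_injective
    simpa [map_ofNat (algebraMap (𝓞 Kp) Kp) 2] using hroot'
  have hc : Odd (b - 2 * (q : ℤ)) := hbodd.sub_even (even_two_mul _)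
  constructor
  · intro hq
    have haodd : Odd a := by
      have hq' : Even (q : ℤ) := by exact_mod_cast hq
      have ha2 : Odd (a ^ 2) := by
        rw [show a ^ 2 = b + q by linarith]
        exact hbodd.add_even hq'
      exact Int.odd_pow.mp ha2 |>.resolve_right (by norm_num)
    exact ⟨haodd, isPrime_span_two_of_root hr haodd hc hdeg⟩
  · intro ha hab
    have hqodd : Odd (q : ℤ) := by
      rw [show (q : ℤ) = a ^ 2 - b by linarith]
      exact (ha.pow_of_ne_zero two_ne_zero).sub_odd hbodd
    obtain ⟨k, hk⟩ := ha
    obtain ⟨u, w, hu, hw⟩ : ∃ u w : ℤ, 2 - a = 2 * u ∧ a - 1 - (b - 2 * q) = 4 * w + 2 := by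
      refine ⟨1 - k, (a - 1 - (b - 2 * q)) / 4, by omega, ?_⟩
      rw [Int.ModEq] at hab
      obtain ⟨i, hi⟩ := hbodd
      obtain ⟨j, hj⟩ := hqodd
      omega
    have hu' := congrArg (Int.cast : ℤ → 𝓞 Kp) hu
    have hw' := congrArg (Int.cast : ℤ → 𝓞 Kp) hw
    push_cast at hu' hw' hr
    have hsq : (r + 1) ^ 2 = 2 * (u : 𝓞 Kp) * (r + 1) + 4 * (w : 𝓞 Kp) + 2 := by
      linear_combination hr + (r + 1) * hu' + hw'
    have h := span_pair_sq_eq_span_two hsq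
    exact ⟨_, isMaximal_of_sq_eq_span_two h hdeg, h.symm⟩
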